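/- Let A be a GNN with layers l_1,…,l_k where layer i has parameters C_i, A_i, b_i (input dimension 2m_i, output dimension n_i, m_i = n_{i-1}) and cls(x) = [a_1 x_1 + ⋯ + a_{n_k} x_{n_k} ≥ 1]. Define K^# formulas φ_{1,j} := (Σ_{r=1}^{m_1} 1_{p_r}·(C_1)_{rj} + #p_r·(A_1)_{rj} + (b_1)_j ≥ 1) for j ≤ n_1, and inductively φ_{i,j} := (Σ_{r=1}^{m_i} 1_{φ_{i-1,r}}·(C_i)_{rj} + #φ_{i-1,r}·(A_i)_{rj} + (b_i)_j ≥ 1). Then for every pointed graph (G,u), every i ≤ k and every j ≤ n_i, the j-th component of x_i(u) equals 1 if (G,u) ⊨ φ_{i,j} and equals 0 otherwise; consequently, A accepts (G,u) if and only if (G,u) ⊨ (a_1·1_{φ_{k,1}} + ⋯ + a_{n_k}·1_{φ_{k,n_k}} ≥ 1). -/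

import Mathlib

/-- A labeled directed graph: finite vertex set, directed edges, and a
labeling of each vertex by a valuation over atomic propositions (ℕ). -/
structure PGraph where
  V : Type
  fintV : Fintype V
  decV : DecidableEq V
  E : V → V → Bool
  label : V → ℕ → Bool

attribute [instance] PGraph.fintV PGraph.decV

mutual
/-- Formulas of the logic K^#. -/
inductive KForm : Type where
  | atom : ℕ → KForm
  | neg : KForm → KForm
  | or : KForm → KForm → KForm
  | geq : KExpr → KForm          -- ξ ≥ 0
/-- Arithmetic expressions of the logic K^#. -/
inductive KExpr : Type where
  | const : ℤ → KExpr
  | one : KForm → KExpr          -- 1_φ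
  | count : KForm → KExpr        -- #φ
  | add : KExpr → KExpr → KExpr
  | mul : ℤ → KExpr → KExpr      -- c × ξ
end

mutual
/-- Truth of a K^# formula at a pointed graph. -/
def KForm.eval (G : PGraph) : G.V → KForm → Bool
  | u, .atom p => G.label u p
  | u, .neg φ => !(KForm.eval G u φ)
  | u, .or φ ψ => KForm.eval G u φ || KForm.eval G u ψ
  | u, .geq ξ => decide (0 ≤ KExpr.eval G u ξ)
/-- Value of a K^# arithmetic expression at a pointed graph. -/
def KExpr.eval (G : PGraph) : G.V → KExpr → ℤ
  | _, .const c => c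
  | u, .one φ => if KForm.eval G u φ then 1 else 0
  | u, .count φ =>
      ((Finset.univ.filter (fun v => G.E u v && KForm.eval G v φ = true)).card : ℤ)
  | u, .add ξ ξ' => KExpr.eval G u ξ + KExpr.eval G u ξ'
  | u, .mul c ξ => c * KExpr.eval G u ξ
end

def KForm.satisfiable (φ : KForm) : Prop := ∃ (G : PGraph) (u : G.V), φ.eval G u = true

def KForm.valid (φ : KForm) : Prop := ∀ (G : PGraph) (u : G.V), φ.eval G u = true

/-- Truncated ReLU. -/
noncomputable def trunc (x : ℝ) : ℝ := max 0 (min 1 x)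

/-- A GNN: `L` layers; layer `t` (for `0 ≤ t < L`) has integer matrices
`C t`, `A t` and integer bias `b t`, mapping states of dimension `dim t` to
states of dimension `dim (t+1)`; `a` gives the integer coefficients of the
final linear classification function. The initial dimension `dim 0` is the
number of atomic propositions used. -/
structure GNN where
  L : ℕ
  dim : ℕ → ℕ
  C : (t : ℕ) → Matrix (Fin (dim t)) (Fin (dim (t + 1))) ℤ
  A : (t : ℕ) → Matrix (Fin (dim t)) (Fin (dim (t + 1))) ℤ
  b : (t : ℕ) → Fin (dim (t + 1)) → ℤ
  a : Fin (dim L) → ℤ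

/-- The state of a GNN on a graph after `t` layers. -/
noncomputable def GNN.state (N : GNN) (G : PGraph) : (t : ℕ) → G.V → Fin (N.dim t) → ℝ
  | 0, u, i => if G.label u i then 1 else 0
  | t + 1, u, j => trunc (
      (∑ i, N.state G t u i * (N.C t i j : ℝ)) +
      (∑ i, (∑ v ∈ Finset.univ.filter (fun v => G.E u v = true), N.state G t v i)
            * (N.A t i j : ℝ)) +
      (N.b t j : ℝ))

/-- The GNN accepts a pointed graph iff `cls(x_L(u)) = 1`, i.e. `Σ a_i x_i ≥ 1`. -/
noncomputable def GNN.accepts (N : GNN) (G : PGraph) (u : G.V) : Prop :=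
  1 ≤ ∑ i, (N.a i : ℝ) * N.state G N.L u i

mutual
/-- Modal depth of a K^# formula. -/
def KForm.md : KForm → ℕ
  | .atom _ => 0
  | .neg φ => φ.md
  | .or φ ψ => max φ.md ψ.md
  | .geq ξ => ξ.md
/-- Modal depth of a K^# expression. -/
def KExpr.md : KExpr → ℕ
  | .const _ => 0
  | .one φ => φ.md
  | .count φ => φ.md + 1
  | .add ξ ξ' => max ξ.md ξ'.md
  | .mul _ ξ => ξ.md
end

mutual
/-- Size (number of syntax-tree nodes) of a K^# formula. -/
def KForm.size : KForm → ℕ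
  | .atom _ => 1
  | .neg φ => φ.size + 1
  | .or φ ψ => φ.size + ψ.size + 1
  | .geq ξ => ξ.size + 1
/-- Size (number of syntax-tree nodes) of a K^# expression. -/
def KExpr.size : KExpr → ℕ
  | .const _ => 1
  | .one φ => φ.size + 1
  | .count φ => φ.size + 1
  | .add ξ ξ' => ξ.size + ξ'.size + 1
  | .mul _ ξ => ξ.size + 2
end

mutual
/-- Atomic propositions occurring in a K^# formula. -/
def KForm.atoms : KForm → Finset ℕ
  | .atom p => {p}
  | .neg φ => φ.atoms
  | .or φ ψ => φ.atoms ∪ ψ.atoms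
  | .geq ξ => ξ.atoms
/-- Atomic propositions occurring in a K^# expression. -/
def KExpr.atoms : KExpr → Finset ℕ
  | .const _ => ∅
  | .one φ => φ.atoms
  | .count φ => φ.atoms
  | .add ξ ξ' => ξ.atoms ∪ ξ'.atoms
  | .mul _ ξ => ξ.atoms
end

/-- Conjunction, defined from ¬ and ∨. -/
def KForm.andF (φ ψ : KForm) : KForm := .neg (.or (.neg φ) (.neg ψ))

/-- Implication, defined from ¬ and ∨. -/
def KForm.impF (φ ψ : KForm) : KForm := .or (.neg φ) ψ

/-- Bi-implication, defined from ¬ and ∨. -/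
def KForm.iffF (φ ψ : KForm) : KForm := KForm.andF (φ.impF ψ) (ψ.impF φ)

/-- The modality □φ, abbreviating `0 − #(¬φ) ≥ 0`. -/
def KForm.box (φ : KForm) : KForm :=
  .geq (.add (.const 0) (.mul (-1) (.count (.neg φ))))

/-- `i`-fold iteration □^i of □. -/
def KForm.boxIter : ℕ → KForm → KForm
  | 0, φ => φ
  | i + 1, φ => KForm.box (KForm.boxIter i φ)

/-- The modality `□^{≤m} φ := ⋀_{0 ≤ i ≤ m} □^i φ`. -/
def KForm.boxUpTo : ℕ → KForm → KForm
  | 0, φ => φ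
  | m + 1, φ => KForm.andF (KForm.boxUpTo m φ) (KForm.boxIter (m + 1) φ)

/-- `#ψ = k`, abbreviating `(#ψ − k ≥ 0) ∧ (k − #ψ ≥ 0)`. -/
def KForm.countEq (ψ : KForm) (k : ℤ) : KForm :=
  KForm.andF (.geq (.add (.count ψ) (.const (-k))))
             (.geq (.add (.const k) (.mul (-1) (.count ψ))))

/-- Sum of a list of K^# expressions. -/
def KExpr.sumList : List KExpr → KExpr
  | [] => .const 0
  | e :: es => .add e (KExpr.sumList es)

/-- The formulas φ_{t,j} built from a GNN: at level 0 they are the atomic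
propositions; at level t+1, `φ_{t+1,j} := Σ_r (1_{φ_{t,r}}·C_rj + #φ_{t,r}·A_rj) + b_j ≥ 1`. -/
def GNN.form (N : GNN) : (t : ℕ) → Fin (N.dim t) → KForm
  | 0, j => .atom j
  | t + 1, j => .geq (.add
      (KExpr.sumList ((List.finRange (N.dim t)).map (fun r =>
        .add (.mul (N.C t r j) (.one (N.form t r)))
             (.mul (N.A t r j) (.count (N.form t r))))))
      (.const (N.b t j - 1)))

/-- The classification formula `a_1·1_{φ_{L,1}} + ⋯ + a_{n_L}·1_{φ_{L,n_L}} ≥ 1`. -/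
def GNN.clsForm (N : GNN) : KForm :=
  .geq (.add
    (KExpr.sumList ((List.finRange (N.dim N.L)).map (fun i =>
      .mul (N.a i) (.one (N.form N.L i)))))
    (.const (-1)))

theorem KExpr.eval_sumList_finRange (G : PGraph) (u : G.V) {n : ℕ} (f : Fin n → KExpr) :
    (KExpr.sumList ((List.finRange n).map f)).eval G u = ∑ i, (f i).eval G u := by
  have sumList_eq (l : List KExpr) :
      (KExpr.sumList l).eval G u = (l.map (KExpr.eval G u)).sum := by
    induction l with
    | nil => simp [KExpr.sumList, KExpr.eval]
    | cons e l ih => simp [KExpr.sumList, KExpr.eval, ih]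
  rw [sumList_eq, List.map_map, ← List.ofFn_eq_map, List.sum_ofFn]
  rfl

theorem trunc_intCast (z : ℤ) : trunc (z : ℝ) = if 1 ≤ z then 1 else 0 := by
  unfold trunc
  split_ifs with h
  · have : (1 : ℝ) ≤ z := by exact_mod_cast h
    simp [this]
  · have : (z : ℝ) ≤ 0 := by exact_mod_cast (show z ≤ 0 by omega)
    rw [max_eq_left ((min_le_right _ _).trans this)]

theorem GNN.state_eq_ite_form (N : GNN) (G : PGraph) (t : ℕ) (u : G.V) (j : Fin (N.dim t)) :
    N.state G t u j = if (N.form t j).eval G u then 1 else 0 := by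
  induction t generalizing u with
  | zero => simp [GNN.state, GNN.form, KForm.eval]
  | succ t ih =>
    set z : ℤ := (∑ r, (N.C t r j * (KExpr.one (N.form t r)).eval G u +
      N.A t r j * (KExpr.count (N.form t r)).eval G u)) + N.b t j with hz
    have eval_form : (N.form (t + 1) j).eval G u = decide (1 ≤ z) := by
      simp only [GNN.form, KForm.eval, KExpr.eval, KExpr.eval_sumList_finRange, hz]
      congr 1
      apply propext
      constructor <;> intro h <;> linarith
    have state_eq : N.state G (t + 1) u j = trunc (z : ℝ) := by
      simp only [GNN.state, ih, hz, KExpr.eval]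
      congr 1
      push_cast
      rw [← Finset.sum_add_distrib]
      congr 1
      refine Finset.sum_congr rfl fun r _ => ?_
      simp [Finset.sum_boole, Finset.filter_filter, mul_comm]
    rw [state_eq, eval_form, trunc_intCast]
    simp

/-- For every layer 1 ≤ t ≤ L and j, the j-th component of x_t(u)
is 1 if (G,u) ⊨ φ_{t,j} and 0 otherwise; consequently, A accepts (G,u) iff
(G,u) satisfies the classification formula. -/
theorem GNN_layerwise_correspondence (N : GNN) (G : PGraph) (u : G.V) :
    (∀ t : ℕ, 1 ≤ t → t ≤ N.L → ∀ j : Fin (N.dim t),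
      N.state G t u j = if (N.form t j).eval G u then 1 else 0) ∧
    (N.accepts G u ↔ N.clsForm.eval G u = true) := by
  refine ⟨fun t _ _ j => N.state_eq_ite_form G t u j, ?_⟩
  have cast_sum : ∑ i, (N.a i : ℝ) * N.state G N.L u i =
      ((∑ i, N.a i * (KExpr.one (N.form N.L i)).eval G u : ℤ) : ℝ) := by
    simp [GNN.state_eq_ite_form, KExpr.eval]
  rw [GNN.accepts, cast_sum, ← Int.cast_one, Int.cast_le]
  simp only [GNN.clsForm, KForm.eval, KExpr.eval, KExpr.eval_sumList_finRange,
    decide_eq_true_eq]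
  constructor <;> intro h <;> linarith
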